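/- arXiv:0712.1372 — 11 statements merged into one kernel-verified Lean document; each statement's English description precedes it below -/
import Mathlib

section
/- Let X be a nonempty finite type and let P : Matrix X X ℝ be a matrix with nonnegative entries whose row sums are all at most 1. Assume P is irreducible (for all x, y ∈ X there exists k ≥ 0 with (P^k) x y > 0) and that there exists at least one x ∈ X with ∑_y P x y < 1. Then for every x, y ∈ X the series ∑_{k=0}^∞ (P^k) x y converges, the matrix (1 - P) is invertible, and (1 - P)⁻¹ x y = ∑_{k=0}^∞ (P^k) x y for all x, y. -/
open Matrix

namespace Matrix

variable {X : Type*} [Fintype X] [DecidableEq X] {P : Matrix X X ℝ}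

lemma pow_apply_nonneg_of_nonneg (hP : ∀ x y, 0 ≤ P x y) (k : ℕ) (x y : X) :
    0 ≤ (P ^ k) x y := by
  induction k generalizing y with
  | zero =>
    rw [pow_zero, one_apply]
    split_ifs <;> norm_num
  | succ k ih =>
    rw [pow_succ, mul_apply]
    exact Finset.sum_nonneg fun z _ => mul_nonneg (ih z) (hP z y)

lemma one_sub_mulVec_one_apply (A : Matrix X X ℝ) (x : X) :
    ((1 - A) *ᵥ 1) x = 1 - ∑ y, A x y := by
  simp [mulVec, dotProduct, one_apply]

/-- The expected number of visits to a state with positive killing probability is finite. -/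
lemma summable_pow_apply_of_row_sum_lt_one (hP : ∀ x y, 0 ≤ P x y)
    (hrow : ∀ x, ∑ y, P x y ≤ 1) {z : X} (hz : ∑ y, P z y < 1) (x : X) :
    Summable fun k : ℕ => (P ^ k) x z := by
  have hpos : 0 < 1 - ∑ y, P z y := sub_pos.2 hz
  refine summable_of_sum_range_le (c := 1 / (1 - ∑ y, P z y))
    (fun k => pow_apply_nonneg_of_nonneg hP k x z) fun n => ?_
  rw [le_div_iff₀ hpos]
  have hnn : ∀ y, 0 ≤ (∑ k ∈ Finset.range n, P ^ k) x y := fun y => by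
    rw [sum_apply]
    exact Finset.sum_nonneg fun k _ => pow_apply_nonneg_of_nonneg hP k x y
  calc (∑ k ∈ Finset.range n, (P ^ k) x z) * (1 - ∑ y, P z y)
      = (∑ k ∈ Finset.range n, P ^ k) x z * ((1 - P) *ᵥ 1) z := by
        rw [one_sub_mulVec_one_apply, sum_apply]
    _ ≤ ∑ y, (∑ k ∈ Finset.range n, P ^ k) x y * ((1 - P) *ᵥ 1) y :=
      Finset.single_le_sum
        (f := fun y => (∑ k ∈ Finset.range n, P ^ k) x y * ((1 - P) *ᵥ 1) y)
        (fun y _ => mul_nonneg (hnn y) <|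
          (sub_nonneg.2 (hrow y)).trans_eq (one_sub_mulVec_one_apply P y).symm)
        (Finset.mem_univ z)
    _ = ((1 - P ^ n) *ᵥ 1) x := by
      rw [← geom_sum_mul_neg, ← mulVec_mulVec]
      rfl
    _ = 1 - ∑ y, (P ^ n) x y := one_sub_mulVec_one_apply _ x
    _ ≤ 1 := sub_le_self _ <|
      Finset.sum_nonneg fun y _ => pow_apply_nonneg_of_nonneg hP n x y

/-- Summability of the visits to `z` passes to every state from which `z` can be reached. -/
lemma summable_pow_apply_of_pow_apply_pos (hP : ∀ x y, 0 ≤ P x y) {x y z : X} {m : ℕ}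
    (hm : 0 < (P ^ m) y z) (hs : Summable fun k : ℕ => (P ^ k) x z) :
    Summable fun k : ℕ => (P ^ k) x y := by
  refine (summable_mul_right_iff hm.ne').1 <|
    ((summable_nat_add_iff m).2 hs).of_nonneg_of_le
      (fun k => mul_nonneg (pow_apply_nonneg_of_nonneg hP k x y) hm.le) fun k => ?_
  rw [pow_add, mul_apply]
  exact Finset.single_le_sum (f := fun w => (P ^ k) x w * (P ^ m) w z)
    (fun w _ => mul_nonneg (pow_apply_nonneg_of_nonneg hP k x w)
      (pow_apply_nonneg_of_nonneg hP m w z)) (Finset.mem_univ y)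

end Matrix

theorem stmt0 {X : Type*} [Fintype X] [Nonempty X] [DecidableEq X]
    (P : Matrix X X ℝ)
    (hnonneg : ∀ x y, 0 ≤ P x y)
    (hrow : ∀ x, ∑ y, P x y ≤ 1)
    (hirr : ∀ x y, ∃ k : ℕ, 0 < (P ^ k) x y)
    (hsub : ∃ x, ∑ y, P x y < 1) :
    (∀ x y, Summable (fun k : ℕ => (P ^ k) x y)) ∧
      IsUnit (1 - P).det ∧
      ∀ x y, (1 - P)⁻¹ x y = ∑' k : ℕ, (P ^ k) x y := by
  obtain ⟨z, hz⟩ := hsub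
  have hs : ∀ x y, Summable fun k : ℕ => (P ^ k) x y := fun x y =>
    have ⟨_, hm⟩ := hirr y z
    summable_pow_apply_of_pow_apply_pos hnonneg hm
      (summable_pow_apply_of_row_sum_lt_one hnonneg hrow hz x)
  have hsum : Summable fun k : ℕ => P ^ k :=
    Pi.summable.2 fun x => Pi.summable.2 fun y => hs x y
  have hinv : (1 - P) * ∑' k : ℕ, P ^ k = 1 := hsum.one_sub_mul_tsum_pow
  refine ⟨hs, isUnit_det_of_right_inverse hinv, fun x y => ?_⟩
  rw [inv_eq_right_inv hinv]
  exact (congrFun (tsum_apply hsum) y).trans (tsum_apply (Pi.summable.1 hsum x))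
end

section
/- Let X be a nonempty finite type and let P : Matrix X X ℝ be a matrix with nonnegative entries such that ∑_y P x y < 1 for every x ∈ X. Then for every x, y ∈ X the series ∑_{k=0}^∞ (P^k) x y converges, the matrix (1 - P) is invertible, and (1 - P)⁻¹ x y = ∑_{k=0}^∞ (P^k) x y for all x, y. -/
section LinftyOpNorm

attribute [local instance] Matrix.linftyOpNormedRing Matrix.linftyOpNormedAlgebra

theorem Matrix.linfty_opNorm_lt_one {X : Type*} [Fintype X] [DecidableEq X]
    {P : Matrix X X ℝ} (hnonneg : ∀ x y, 0 ≤ P x y) (hrow : ∀ x, ∑ y, P x y < 1) :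
    ‖P‖ < 1 := by
  rw [← coe_nnnorm, ← NNReal.coe_one, NNReal.coe_lt_coe, Matrix.linfty_opNNNorm_def,
    Finset.sup_lt_iff (by simp)]
  intro x _
  rw [← NNReal.coe_lt_coe]
  simpa [abs_of_nonneg, hnonneg] using hrow x

theorem Matrix.summable_pow_of_row_sum_lt_one {X : Type*} [Fintype X] [DecidableEq X]
    {P : Matrix X X ℝ} (hnonneg : ∀ x y, 0 ≤ P x y) (hrow : ∀ x, ∑ y, P x y < 1) :
    Summable (fun k : ℕ => P ^ k) := by
  have := FiniteDimensional.complete ℝ (Matrix X X ℝ)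
  exact summable_geometric_of_norm_lt_one (Matrix.linfty_opNorm_lt_one hnonneg hrow)

end LinftyOpNorm

open Matrix

theorem stmt1 {X : Type*} [Fintype X] [Nonempty X] [DecidableEq X]
    (P : Matrix X X ℝ)
    (hnonneg : ∀ x y, 0 ≤ P x y)
    (hrow : ∀ x, ∑ y, P x y < 1) :
    (∀ x y, Summable (fun k : ℕ => (P ^ k) x y)) ∧
      IsUnit (1 - P).det ∧
      ∀ x y, (1 - P)⁻¹ x y = ∑' k : ℕ, (P ^ k) x y := by
  have hP : Summable (fun k : ℕ => P ^ k) :=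
    Matrix.summable_pow_of_row_sum_lt_one hnonneg hrow
  have hmul : (1 - P) * ∑' k : ℕ, P ^ k = 1 := hP.one_sub_mul_tsum_pow
  refine ⟨fun x y => Pi.summable.1 (Pi.summable.1 hP x) y,
    Matrix.isUnit_det_of_right_inverse hmul, fun x y => ?_⟩
  rw [Matrix.inv_eq_right_inv hmul]
  exact (congrFun (tsum_apply hP) y).trans (tsum_apply (Pi.summable.1 hP x))
end

section
/- Let X be a nonempty finite type and let Q : Matrix X X ℝ be a generator matrix. Let P be its jump matrix, and assume that for every x, y ∈ X the series ∑_{k=0}^∞ (P^k) x y converges. Then Q is invertible, Q⁻¹ = (∑_{k=0}^∞ P^k) * diagonal (fun x => (Q x x)⁻¹) (where the sum of matrices is taken entrywise), and every entry of −Q⁻¹ is nonnegative. -/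
open Matrix

/-- A summable Neumann series of a matrix is a right inverse of `1 - P`. -/
theorem Matrix.one_sub_mul_tsum_pow {X : Type*} [Fintype X] [DecidableEq X]
    (P : Matrix X X ℝ) (hsum : ∀ x y, Summable (fun k : ℕ => (P ^ k) x y)) :
    (1 - P) * (Matrix.of fun x y => ∑' k : ℕ, (P ^ k) x y) = 1 := by
  ext x y
  have h : (P * Matrix.of fun x y => ∑' k : ℕ, (P ^ k) x y) x y
      = ∑' k : ℕ, (P ^ (k + 1)) x y := by
    simp only [pow_succ', mul_apply, of_apply]
    rw [Summable.tsum_finsetSum fun z _ => (hsum z y).mul_left _]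
    simp only [tsum_mul_left]
  rw [sub_mul, one_mul, Matrix.sub_apply, h, of_apply, (hsum x y).tsum_eq_zero_add, pow_zero]
  ring

theorem stmt2 {X : Type*} [Fintype X] [Nonempty X] [DecidableEq X]
    (Q : Matrix X X ℝ) (hsymm : Q.IsSymm)
    (hoff : ∀ x y, x ≠ y → 0 ≤ Q x y) (hdiag : ∀ x, Q x x < 0)
    (P : Matrix X X ℝ)
    (hP : ∀ x y, P x y = if x = y then 0 else - Q x y / Q x x)
    (hsum : ∀ x y, Summable (fun k : ℕ => (P ^ k) x y)) :
    IsUnit Q.det ∧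
      Q⁻¹ = (Matrix.of fun x y => ∑' k : ℕ, (P ^ k) x y) *
        Matrix.diagonal (fun x => (Q x x)⁻¹) ∧
      ∀ x y, 0 ≤ (-Q⁻¹) x y := by
  have hPnn : ∀ x y, 0 ≤ P x y := fun x y => by
    rw [hP]
    split_ifs with h
    · exact le_rfl
    · exact div_nonneg_of_nonpos (neg_nonpos.2 (hoff x y h)) (hdiag x).le
  have hpow : ∀ (k : ℕ) x y, 0 ≤ (P ^ k) x y := fun k => by
    induction k with
    | zero =>
      intro x y
      rw [pow_zero, one_apply]
      split_ifs <;> norm_num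
    | succ k ih =>
      intro x y
      rw [pow_succ, mul_apply]
      exact Finset.sum_nonneg fun z _ => mul_nonneg (ih x z) (hPnn z y)
  have hQ : Q = diagonal (fun x => Q x x) * (1 - P) := by
    ext x y
    have hx := (hdiag x).ne
    rw [diagonal_mul, Matrix.sub_apply, hP, one_apply]
    split_ifs with h
    · subst h
      ring
    · field_simp
      ring
  have hmul : Q * ((Matrix.of fun x y => ∑' k : ℕ, (P ^ k) x y) *
      diagonal (fun x => (Q x x)⁻¹)) = 1 := by
    have hD : diagonal (fun x => Q x x) * diagonal (fun x => (Q x x)⁻¹) = 1 := by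
      simp [diagonal_mul_diagonal, fun x => mul_inv_cancel₀ (hdiag x).ne]
    conv_lhs => arg 1; rw [hQ]
    rw [Matrix.mul_assoc, ← Matrix.mul_assoc (1 - P), one_sub_mul_tsum_pow P hsum,
      Matrix.one_mul, hD]
  have hinv := inv_eq_right_inv hmul
  refine ⟨isUnit_det_of_right_inverse hmul, hinv, fun x y => ?_⟩
  rw [hinv, Matrix.neg_apply, mul_diagonal, of_apply, neg_nonneg]
  exact mul_nonpos_of_nonneg_of_nonpos (tsum_nonneg fun k => hpow k x y)
    (inv_nonpos.2 (hdiag y).le)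
end

section
/- Let X be a nonempty finite type, let Q : Matrix X X ℝ be a generator matrix with jump matrix P, and let S be a sign matrix on X. Assume that for every x, y ∈ X the series ∑_{k=0}^∞ (P^k) x y converges. Then the matrix −(Q ∘ S) is invertible and (−(Q ∘ S))⁻¹ = (∑_{k=0}^∞ (P ∘ S)^k) * diagonal (fun x => −(Q x x)⁻¹), where the matrix series converges entrywise (absolutely). -/
open Matrix

/-- If a real matrix `M` is dominated entrywise by `P`, then so are its powers. -/
theorem Matrix.abs_pow_apply_le {X : Type*} [Fintype X] [DecidableEq X] {M P : Matrix X X ℝ}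
    (h : ∀ x y, |M x y| ≤ P x y) (k : ℕ) (x y : X) : |(M ^ k) x y| ≤ (P ^ k) x y := by
  induction k generalizing x y with
  | zero =>
    by_cases hxy : x = y <;> simp [hxy]
  | succ k ih =>
    rw [pow_succ, pow_succ, mul_apply, mul_apply]
    refine (Finset.abs_sum_le_sum_abs _ _).trans (Finset.sum_le_sum fun z _ => ?_)
    rw [abs_mul]
    exact mul_le_mul (ih x z) (h z y) (abs_nonneg _) ((abs_nonneg _).trans (ih x z))

/-- The entrywise Neumann series of `M` is a right inverse of `1 - M`. -/
theorem Matrix.one_sub_mul_of_tsum_pow {X : Type*} [Fintype X] [DecidableEq X]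
    {M : Matrix X X ℝ} (h : ∀ x y, Summable fun k : ℕ => (M ^ k) x y) :
    (1 - M) * Matrix.of (fun x y => ∑' k : ℕ, (M ^ k) x y) = 1 := by
  have hM : HasSum (fun k : ℕ => M ^ k) (Matrix.of fun x y => ∑' k : ℕ, (M ^ k) x y) :=
    Pi.hasSum.2 fun x => Pi.hasSum.2 fun y => (h x y).hasSum
  rw [← hM.tsum_eq]
  exact hM.summable.one_sub_mul_tsum_pow

theorem stmt5 {X : Type*} [Fintype X] [Nonempty X] [DecidableEq X]
    (Q S : Matrix X X ℝ) (hQsymm : Q.IsSymm)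
    (hoff : ∀ x y, x ≠ y → 0 ≤ Q x y) (hdiag : ∀ x, Q x x < 0)
    (hSdiag : ∀ x, S x x = 1) (hSsymm : ∀ x y, S x y = S y x)
    (hSval : ∀ x y, x ≠ y → S x y = -1 ∨ S x y = 1)
    (P : Matrix X X ℝ)
    (hP : ∀ x y, P x y = if x = y then 0 else - Q x y / Q x x)
    (hsum : ∀ x y, Summable fun k : ℕ => (P ^ k) x y) :
    IsUnit (-(Q.hadamard S)).det ∧
      (∀ x y, Summable fun k : ℕ => |((P.hadamard S) ^ k) x y|) ∧
      (-(Q.hadamard S))⁻¹ =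
        (Matrix.of fun x y => ∑' k : ℕ, ((P.hadamard S) ^ k) x y) *
          Matrix.diagonal (fun x => -(Q x x)⁻¹) := by
  have hdom : ∀ x y, |(P.hadamard S) x y| ≤ P x y := by
    intro x y
    rw [hadamard_apply, hP]
    split_ifs with hxy
    · simp
    · have hnn : 0 ≤ -Q x y / Q x x :=
        div_nonneg_of_nonpos (neg_nonpos.2 (hoff x y hxy)) (hdiag x).le
      rcases hSval x y hxy with hs | hs <;> simp only [hs, mul_neg, mul_one, abs_neg] <;>
        exact (abs_of_nonneg hnn).le
  have habs : ∀ x y, Summable fun k : ℕ => |((P.hadamard S) ^ k) x y| := fun x y =>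
    (hsum x y).of_nonneg_of_le (fun _ => abs_nonneg _) fun k => abs_pow_apply_le hdom k x y
  have hfactor : -(Q.hadamard S) = diagonal (fun x => -Q x x) * (1 - P.hadamard S) := by
    ext x y
    rw [diagonal_mul, Matrix.neg_apply, Matrix.sub_apply, hadamard_apply, hadamard_apply, hP]
    by_cases hxy : x = y
    · subst hxy
      simp [hSdiag]
    · have := (hdiag x).ne
      rw [if_neg hxy, one_apply_ne hxy]
      field_simp
      ring
  have hdiag_mul : diagonal (fun x => -Q x x) * diagonal (fun x => -(Q x x)⁻¹) = 1 := by
    rw [diagonal_mul_diagonal, ← diagonal_one]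
    congr 1
    funext x
    rw [neg_mul_neg, mul_inv_cancel₀ (hdiag x).ne]
  have hright : -(Q.hadamard S) *
      ((Matrix.of fun x y => ∑' k : ℕ, ((P.hadamard S) ^ k) x y) *
        diagonal (fun x => -(Q x x)⁻¹)) = 1 := by
    rw [hfactor, Matrix.mul_assoc, ← Matrix.mul_assoc (1 - _),
      one_sub_mul_of_tsum_pow fun x y => (habs x y).of_abs, Matrix.one_mul, hdiag_mul]
  exact ⟨isUnit_det_of_right_inverse hright, habs, inv_eq_right_inv hright⟩
end

section
/- Let n ≥ 1, let N : Matrix (Fin n) (Fin n) ℝ be a symmetric positive definite matrix, and fix x, y ∈ Fin n. Then ∫_{ℝ^n} z x * z y * exp(−(1/2) ∑_{i,j} z i * N i j * z j) dz = (2π)^{n/2} * (det N)^{−1/2} * N⁻¹ x y, where the integral is with respect to n-dimensional Lebesgue measure. -/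
open Matrix

open MeasureTheory ProbabilityTheory

theorem gaussianPDFReal_zero_one (t : ℝ) :
    gaussianPDFReal 0 1 t = (√(2 * Real.pi))⁻¹ * Real.exp (-(1/2) * t ^ 2) := by
  simp only [gaussianPDFReal, NNReal.coe_one, mul_one, sub_zero]
  congr 2
  ring

theorem integral_mul_exp_neg_half_sq (f : ℝ → ℝ) :
    ∫ t, f t * Real.exp (-(1/2) * t ^ 2) = √(2 * Real.pi) * ∫ t, f t ∂(gaussianReal 0 1) := by
  have hs : √(2 * Real.pi) ≠ 0 := by positivity
  rw [integral_gaussianReal_eq_integral_smul one_ne_zero, ← integral_const_mul]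
  refine integral_congr_ae (.of_forall fun t ↦ ?_)
  simp only [gaussianPDFReal_zero_one, smul_eq_mul]
  field_simp

theorem integrable_pow_mul_exp_neg_half_sq (k : ℕ) :
    Integrable fun t : ℝ ↦ t ^ k * Real.exp (-(1/2) * t ^ 2) := by
  have h := integrable_rpow_mul_exp_neg_mul_sq (b := 1/2) (by norm_num) (s := k)
    (lt_of_lt_of_le (by norm_num) k.cast_nonneg)
  simpa only [Real.rpow_natCast] using h

theorem integral_exp_neg_half_sq :
    ∫ t : ℝ, Real.exp (-(1/2) * t ^ 2) = √(2 * Real.pi) := by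
  simpa using integral_mul_exp_neg_half_sq fun _ ↦ 1

theorem integral_id_mul_exp_neg_half_sq :
    ∫ t : ℝ, t * Real.exp (-(1/2) * t ^ 2) = 0 := by
  rw [integral_mul_exp_neg_half_sq fun t ↦ t, integral_id_gaussianReal, mul_zero]

theorem integral_sq_mul_exp_neg_half_sq :
    ∫ t : ℝ, t ^ 2 * Real.exp (-(1/2) * t ^ 2) = √(2 * Real.pi) := by
  have h : ∫ t, t ^ 2 ∂(gaussianReal 0 1) = 1 := by
    have := variance_fun_id_gaussianReal (μ := 0) (v := 1)
    rwa [variance_of_integral_eq_zero (by fun_prop) integral_id_gaussianReal] at this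
  rw [integral_mul_exp_neg_half_sq fun t ↦ t ^ 2, h, mul_one]

section Moments

variable {ι : Type*} [Fintype ι] [DecidableEq ι]

theorem mul_mul_exp_neg_half_sum_sq_eq_prod (i j : ι) (w : ι → ℝ) :
    w i * w j * Real.exp (-(1/2) * ∑ k, w k ^ 2) =
      ∏ k, w k ^ ((if k = i then 1 else 0) + (if k = j then 1 else 0)) *
        Real.exp (-(1/2) * w k ^ 2) := by
  rw [Finset.mul_sum, Real.exp_sum, Finset.prod_mul_distrib]
  simp_rw [pow_add, Finset.prod_mul_distrib, pow_ite, pow_one, pow_zero]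
  simp

theorem integrable_mul_mul_exp_neg_half_sum_sq (i j : ι) :
    Integrable fun w : ι → ℝ ↦ w i * w j * Real.exp (-(1/2) * ∑ k, w k ^ 2) := by
  simp_rw [mul_mul_exp_neg_half_sum_sq_eq_prod]
  exact Integrable.fintype_prod (f := fun k (t : ℝ) ↦
    t ^ ((if k = i then 1 else 0) + (if k = j then 1 else 0)) * Real.exp (-(1/2) * t ^ 2))
    fun k ↦ integrable_pow_mul_exp_neg_half_sq _

theorem integral_mul_mul_exp_neg_half_sum_sq (i j : ι) :
    ∫ w : ι → ℝ, w i * w j * Real.exp (-(1/2) * ∑ k, w k ^ 2) =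
      if i = j then √(2 * Real.pi) ^ Fintype.card ι else 0 := by
  simp_rw [mul_mul_exp_neg_half_sum_sq_eq_prod]
  rw [integral_fintype_prod_volume_eq_prod (f := fun k (t : ℝ) ↦
    t ^ ((if k = i then 1 else 0) + (if k = j then 1 else 0)) * Real.exp (-(1/2) * t ^ 2))]
  split_ifs with h
  · subst h
    rw [← Finset.card_univ]
    refine Finset.prod_eq_pow_card fun k _ ↦ ?_
    by_cases hk : k = i
    · simpa only [if_pos hk] using integral_sq_mul_exp_neg_half_sq
    · simpa [if_neg hk] using integral_exp_neg_half_sq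
  · refine Finset.prod_eq_zero (Finset.mem_univ i) ?_
    simpa [h] using integral_id_mul_exp_neg_half_sq

theorem integral_mulVec_mul_mulVec_mul_exp_neg_half_sum_sq (A : Matrix ι ι ℝ) (x y : ι) :
    ∫ w : ι → ℝ, (A *ᵥ w) x * (A *ᵥ w) y * Real.exp (-(1/2) * ∑ k, w k ^ 2) =
      √(2 * Real.pi) ^ Fintype.card ι * (A * Aᵀ) x y := by
  have h (w : ι → ℝ) : (A *ᵥ w) x * (A *ᵥ w) y * Real.exp (-(1/2) * ∑ k, w k ^ 2) =
      ∑ i, ∑ j, A x i * A y j * (w i * w j * Real.exp (-(1/2) * ∑ k, w k ^ 2)) := by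
    simp only [mulVec, dotProduct]
    rw [Finset.sum_mul_sum, Finset.sum_mul]
    refine Finset.sum_congr rfl fun i _ ↦ ?_
    rw [Finset.sum_mul]
    exact Finset.sum_congr rfl fun j _ ↦ by ring
  have hint (i j : ι) := (integrable_mul_mul_exp_neg_half_sum_sq i j).const_mul (A x i * A y j)
  simp_rw [h]
  rw [integral_finsetSum _ fun i _ ↦ integrable_finsetSum _ fun j _ ↦ hint i j]
  simp_rw [integral_finsetSum _ fun j _ ↦ hint _ j, integral_const_mul,
    integral_mul_mul_exp_neg_half_sum_sq]
  simp [mul_apply, Finset.mul_sum, mul_comm]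

theorem integral_comp_mulVec {B : Matrix ι ι ℝ} (hB : B.det ≠ 0) (g : (ι → ℝ) → ℝ)
    (hg : Continuous g) : ∫ z, g (B *ᵥ z) = |B.det|⁻¹ * ∫ w, g w := by
  have h := integral_map (μ := (volume : Measure (ι → ℝ))) (φ := toLin' B) (f := g)
    (LinearMap.continuous_on_pi _).aemeasurable hg.aestronglyMeasurable
  rw [Real.map_matrix_volume_pi_eq_smul_volume_pi hB, integral_smul_measure,
    ENNReal.toReal_ofReal (abs_nonneg _), abs_inv, smul_eq_mul] at h
  simpa using h.symm

end Moments

theorem stmt7 (n : ℕ) (hn : 1 ≤ n) (N : Matrix (Fin n) (Fin n) ℝ)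
    (hsymm : N.IsSymm) (hpos : N.PosDef) (x y : Fin n) :
    ∫ z : Fin n → ℝ, z x * z y * Real.exp (-(1/2) * ∑ i, ∑ j, z i * N i j * z j) =
      (2 * Real.pi) ^ ((n : ℝ) / 2) * N.det ^ (-(1 : ℝ) / 2) * N⁻¹ x y := by
  obtain ⟨B, hB⟩ : ∃ B : Matrix (Fin n) (Fin n) ℝ, N = Bᵀ * B := by
    open scoped MatrixOrder Matrix.Norms.L2Operator in
    obtain ⟨B, hB⟩ := CStarAlgebra.nonneg_iff_eq_star_mul_self.mp hpos.posSemidef.nonneg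
    exact ⟨B, by rw [hB, star_eq_conjTranspose, conjTranspose_eq_transpose_of_trivial]⟩
  have hdet : N.det = B.det ^ 2 := by rw [hB, det_mul, det_transpose, sq]
  have hB0 : B.det ≠ 0 := fun h ↦ hpos.det_pos.ne' (by rw [hdet, h]; norm_num)
  have hquad (z : Fin n → ℝ) : ∑ i, ∑ j, z i * N i j * z j = ∑ k, (B *ᵥ z) k ^ 2 := by
    have h : z ⬝ᵥ N *ᵥ z = (B *ᵥ z) ⬝ᵥ (B *ᵥ z) := by
      rw [hB, ← mulVec_mulVec, dotProduct_mulVec, vecMul_transpose]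
    simpa [dotProduct, mulVec, Finset.mul_sum, mul_assoc, sq] using h
  have hcancel (z : Fin n → ℝ) : B⁻¹ *ᵥ (B *ᵥ z) = z := by
    rw [mulVec_mulVec, nonsing_inv_mul _ hB0.isUnit, one_mulVec]
  have hsubst := integral_comp_mulVec hB0
    (fun w ↦ (B⁻¹ *ᵥ w) x * (B⁻¹ *ᵥ w) y * Real.exp (-(1/2) * ∑ k, w k ^ 2))
    (by simp only [mulVec, dotProduct]; fun_prop)
  simp only [hcancel] at hsubst
  have hpi : √(2 * Real.pi) ^ n = (2 * Real.pi) ^ ((n : ℝ) / 2) := by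
    rw [Real.sqrt_eq_rpow, ← Real.rpow_natCast, ← Real.rpow_mul (by positivity)]
    ring_nf
  have hdet' : N.det ^ (-(1 : ℝ) / 2) = |B.det|⁻¹ := by
    rw [neg_div, Real.rpow_neg hpos.det_pos.le, ← Real.sqrt_eq_rpow, hdet, Real.sqrt_sq_eq_abs]
  have hinv : N⁻¹ = B⁻¹ * (B⁻¹)ᵀ := by rw [hB, Matrix.mul_inv_rev, transpose_nonsing_inv]
  simp_rw [hquad]
  rw [hsubst, integral_mulVec_mul_mulVec_mul_exp_neg_half_sum_sq, Fintype.card_fin, hpi, hdet',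
    hinv]
  ring
end

section
/- Let n ≥ 1, let M : Matrix (Fin n) (Fin n) ℝ be symmetric positive definite, let d : Fin n → ℝ be nonnegative, and let D = diagonal d. Let Z be a random vector in ℝ^n distributed as the centered multivariate Gaussian with covariance matrix M⁻¹. Then for all x, y ∈ Fin n, E[ Z x * Z y * exp(−(1/2) ∑_u d u * (Z u)²) ] = E[ exp(−(1/2) ∑_u d u * (Z u)²) ] * (M + D)⁻¹ x y. -/
open Matrix MeasureTheory

namespace Matrix.PosDef

variable {ι : Type*} [Fintype ι] {A : Matrix ι ι ℝ}

/-- A positive definite quadratic form dominates a positive multiple of the sum of squares. -/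
lemma exists_pos_mul_sum_sq_le [Nonempty ι] (hA : A.PosDef) :
    ∃ c : ℝ, 0 < c ∧ ∀ z : ι → ℝ, c * ∑ i, z i ^ 2 ≤ z ⬝ᵥ A *ᵥ z := by
  have hcont : Continuous fun z : ι → ℝ => z ⬝ᵥ A *ᵥ z := by fun_prop
  obtain ⟨w, hw, hmin⟩ := (isCompact_sphere (0 : ι → ℝ) 1).exists_isMinOn
    (NormedSpace.sphere_nonempty.mpr zero_le_one) hcont.continuousOn
  have hw0 : w ≠ 0 := by
    rintro rfl
    simp at hw
  have hpos : 0 < w ⬝ᵥ A *ᵥ w := by simpa using hA.dotProduct_mulVec_pos hw0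
  have hcard : (0 : ℝ) < Fintype.card ι := by exact_mod_cast Fintype.card_pos
  refine ⟨(w ⬝ᵥ A *ᵥ w) / Fintype.card ι, by positivity, fun z => ?_⟩
  have hsum : ∑ i, z i ^ 2 ≤ Fintype.card ι * ‖z‖ ^ 2 := by
    calc ∑ i, z i ^ 2 ≤ ∑ _i : ι, ‖z‖ ^ 2 := Finset.sum_le_sum fun i _ => by
          rw [← sq_abs]
          exact pow_le_pow_left₀ (abs_nonneg _) (norm_le_pi_norm z i) 2
      _ = Fintype.card ι * ‖z‖ ^ 2 := by simp
  rcases eq_or_ne z 0 with rfl | hz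
  · simp
  have hz' : 0 < ‖z‖ := norm_pos_iff.mpr hz
  have hle : w ⬝ᵥ A *ᵥ w ≤ (‖z‖⁻¹ • z) ⬝ᵥ A *ᵥ (‖z‖⁻¹ • z) :=
    hmin (by simp [norm_smul, hz'.ne'])
  rw [mulVec_smul, smul_dotProduct, dotProduct_smul, smul_eq_mul, smul_eq_mul] at hle
  calc (w ⬝ᵥ A *ᵥ w) / Fintype.card ι * ∑ i, z i ^ 2
      ≤ (w ⬝ᵥ A *ᵥ w) / Fintype.card ι * (Fintype.card ι * ‖z‖ ^ 2) := by gcongr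
    _ = (w ⬝ᵥ A *ᵥ w) * ‖z‖ ^ 2 := by field_simp
    _ ≤ (‖z‖⁻¹ * (‖z‖⁻¹ * (z ⬝ᵥ A *ᵥ z))) * ‖z‖ ^ 2 := by gcongr
    _ = z ⬝ᵥ A *ᵥ z := by field_simp

/-- Functions of at most quadratic growth are integrable against a Gaussian weight. -/
lemma integrable_mul_exp_neg_half [Nonempty ι] (hA : A.PosDef) {f : (ι → ℝ) → ℝ}
    (hf : Continuous f) (hbound : ∀ z, |f z| ≤ 1 + ∑ i, z i ^ 2) :
    Integrable fun z => f z * Real.exp (-(1/2) * (z ⬝ᵥ A *ᵥ z)) := by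
  obtain ⟨c, hc, hle⟩ := hA.exists_pos_mul_sum_sq_le
  have hprod : Integrable fun z : ι → ℝ => (1 + 4 / c) * ∏ i, Real.exp (-(c / 4) * z i ^ 2) :=
    (Integrable.fintype_prod (fun _ => integrable_exp_neg_mul_sq (by positivity))).const_mul _
  refine hprod.mono' (by fun_prop) (ae_of_all _ fun z => ?_)
  have hS : 0 ≤ ∑ i, z i ^ 2 := by positivity
  rw [← Real.exp_sum, ← Finset.mul_sum, Real.norm_eq_abs, abs_mul, Real.abs_exp]
  set S := ∑ i, z i ^ 2
  have hpoly : 1 + S ≤ (1 + 4 / c) * Real.exp (c / 4 * S) := by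
    have hexp := Real.add_one_le_exp (c / 4 * S)
    calc 1 + S ≤ (1 + 4 / c) * (c / 4 * S + 1) := by
          have : (1 + 4 / c) * (c / 4 * S + 1) = 1 + S + (c / 4 * S + 4 / c) := by
            field_simp
            ring
          rw [this]
          have : 0 ≤ c / 4 * S + 4 / c := by positivity
          linarith
      _ ≤ _ := by gcongr
  calc |f z| * Real.exp (-(1/2) * (z ⬝ᵥ A *ᵥ z))
      ≤ (1 + 4 / c) * Real.exp (c / 4 * S) * Real.exp (-(1/2) * (c * S)) := by
        refine mul_le_mul ((hbound z).trans hpoly) (Real.exp_le_exp.mpr ?_)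
          (Real.exp_pos _).le (by positivity)
        linarith [hle z]
    _ = (1 + 4 / c) * Real.exp (-(c / 4) * S) := by
        rw [mul_assoc, ← Real.exp_add]
        ring_nf

variable [DecidableEq ι]

lemma hasLineDerivAt_exp_neg_half (hA : A.PosDef) (z : ι → ℝ) (j : ι) :
    HasLineDerivAt ℝ (fun z : ι → ℝ => Real.exp (-(1/2) * (z ⬝ᵥ A *ᵥ z)))
      (-(A *ᵥ z) j * Real.exp (-(1/2) * (z ⬝ᵥ A *ᵥ z))) z (Pi.single j 1) := by
  have hsymm : Aᵀ = A := by simpa using hA.isHermitian.eq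
  have hquad : ∀ t : ℝ, (z + t • Pi.single j 1) ⬝ᵥ A *ᵥ (z + t • Pi.single j 1) =
      z ⬝ᵥ A *ᵥ z + 2 * t * (A *ᵥ z) j + t ^ 2 * A j j := by
    intro t
    have hswap : z ⬝ᵥ A *ᵥ Pi.single j 1 = (A *ᵥ z) j := by
      rw [dotProduct_mulVec, ← mulVec_transpose, hsymm, dotProduct_single_one]
    simp only [mulVec_add, mulVec_smul, add_dotProduct, dotProduct_add, smul_dotProduct,
      dotProduct_smul, single_one_dotProduct, smul_eq_mul, hswap]
    simp
    ring
  have hderiv : HasDerivAt (fun t : ℝ => -(1/2) * (z ⬝ᵥ A *ᵥ z + 2 * t * (A *ᵥ z) j +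
      t ^ 2 * A j j)) (-(A *ᵥ z) j) 0 := by
    have h1 := ((hasDerivAt_id (0 : ℝ)).const_mul 2).mul_const ((A *ᵥ z) j)
    have h2 := (hasDerivAt_pow 2 (0 : ℝ)).mul_const (A j j)
    exact (((h1.const_add (z ⬝ᵥ A *ᵥ z)).add h2).const_mul (-(1/2))).congr_deriv (by simp)
  unfold HasLineDerivAt
  simp only [hquad]
  exact hderiv.exp.congr_deriv (by simp [mul_comm])

/-- Second moments of an unnormalised centered Gaussian with precision matrix `A`. -/
theorem integral_mul_mul_exp_neg_half [Nonempty ι] (hA : A.PosDef) (x y : ι) :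
    ∫ z : ι → ℝ, z x * z y * Real.exp (-(1/2) * (z ⬝ᵥ A *ᵥ z)) =
      (∫ z : ι → ℝ, Real.exp (-(1/2) * (z ⬝ᵥ A *ᵥ z))) * A⁻¹ x y := by
  set g : (ι → ℝ) → ℝ := fun z => Real.exp (-(1/2) * (z ⬝ᵥ A *ᵥ z))
  have hsq : ∀ (z : ι → ℝ) i, z i ^ 2 ≤ ∑ i, z i ^ 2 := fun z i =>
    Finset.single_le_sum (f := fun i => z i ^ 2) (fun _ _ => sq_nonneg _) (Finset.mem_univ i)
  have h_integrable0 : Integrable g := by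
    simpa only [one_mul] using hA.integrable_mul_exp_neg_half (f := fun _ => 1) continuous_const
      (fun z => by simpa using Finset.sum_nonneg fun i _ => sq_nonneg (z i))
  have h_integrable1 : ∀ i, Integrable fun z => z i * g z := fun i =>
    hA.integrable_mul_exp_neg_half (f := fun z => z i) (by fun_prop) fun z => by
      refine (?_ : |z i| ≤ 1 + z i ^ 2).trans (by gcongr; exact hsq z i)
      nlinarith [sq_abs (z i), sq_nonneg (|z i| - 1)]
  have h_integrable2 : ∀ i j, Integrable fun z => z i * z j * g z := fun i j =>
    hA.integrable_mul_exp_neg_half (f := fun z => z i * z j) (by fun_prop) fun z => by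
      rw [abs_mul]
      nlinarith [sq_abs (z i), sq_abs (z j), sq_nonneg (|z i| - |z j|), hsq z i, hsq z j]
  set S : Matrix ι ι ℝ := of fun i j => ∫ z, z i * z j * g z with hS
  have hexpand : ∀ i j z, z i * (-(A *ᵥ z) j * g z) = -∑ k, A j k * (z i * z k * g z) := by
    intro i j z
    simp only [mulVec, dotProduct, Finset.mul_sum, Finset.sum_mul, neg_mul, mul_neg]
    congr 1
    exact Finset.sum_congr rfl fun k _ => by ring
  have h_integrable3 : ∀ i j, Integrable fun z => z i * (-(A *ᵥ z) j * g z) := by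
    intro i j
    simp only [hexpand]
    exact (integrable_finsetSum _ fun k _ => (h_integrable2 i k).const_mul _).neg
  have hSA : S * A = (∫ z, g z) • (1 : Matrix ι ι ℝ) := by
    ext i j
    have hparts := integral_bilinear_hasLineDerivAt_right_eq_neg_left_of_integrable
      (μ := (volume : Measure (ι → ℝ))) (B := ContinuousLinearMap.mul ℝ ℝ)
      (f := fun z => z i) (f' := fun _ => (Pi.single j 1 : ι → ℝ) i) (g := g)
      (g' := fun z => -(A *ᵥ z) j * g z) (v := Pi.single j 1)
      (h_integrable0.const_mul _) (h_integrable3 i j) (h_integrable1 i)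
      (fun z _ => by
        unfold HasLineDerivAt
        simpa using ((hasDerivAt_id (0 : ℝ)).mul_const ((Pi.single j 1 : ι → ℝ) i)).const_add (z i))
      (fun z _ => hA.hasLineDerivAt_exp_neg_half z j)
    simp only [ContinuousLinearMap.mul_apply', hexpand, integral_neg, integral_const_mul] at hparts
    rw [integral_finsetSum _ fun k _ => (h_integrable2 i k).const_mul _] at hparts
    simp only [integral_const_mul, neg_inj] at hparts
    have hsymm : ∀ k, A k j = A j k := fun k => by simpa using hA.isHermitian.apply j k
    simp only [mul_apply, smul_apply, one_apply, smul_eq_mul, hS, of_apply, hsymm]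
    rw [mul_comm, ← Pi.single_apply, ← hparts]
    exact Finset.sum_congr rfl fun k _ => mul_comm _ _
  have hdet : IsUnit A.det := (isUnit_iff_isUnit_det A).mp hA.isUnit
  have hSinv : S = (∫ z, g z) • A⁻¹ := by
    rw [← mul_nonsing_inv_cancel_right A S hdet, hSA, smul_mul_assoc, one_mul]
  exact congrFun (congrFun hSinv x) y

end Matrix.PosDef


theorem stmt8 (n : ℕ) (hn : 1 ≤ n) (M : Matrix (Fin n) (Fin n) ℝ)
    (hsymm : M.IsSymm) (hpos : M.PosDef)
    (d : Fin n → ℝ) (hd : ∀ u, 0 ≤ d u)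
    (μ : Measure (Fin n → ℝ))
    (hμ : μ = volume.withDensity fun z =>
      ENNReal.ofReal ((2 * Real.pi) ^ (-(n : ℝ) / 2) * (M⁻¹).det ^ (-(1 : ℝ) / 2) *
        Real.exp (-(1/2) * ∑ i, ∑ j, z i * (M⁻¹)⁻¹ i j * z j)))
    (x y : Fin n) :
    ∫ z, z x * z y * Real.exp (-(1/2) * ∑ u, d u * (z u) ^ 2) ∂μ =
      (∫ z, Real.exp (-(1/2) * ∑ u, d u * (z u) ^ 2) ∂μ) *
        (M + Matrix.diagonal d)⁻¹ x y := by
  have hdet : IsUnit M.det := (isUnit_iff_isUnit_det M).mp hpos.isUnit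
  have : Nonempty (Fin n) := ⟨x⟩
  have hA : (M + diagonal d).PosDef := hpos.add_posSemidef (PosSemidef.diagonal hd)
  set c : ℝ := (2 * Real.pi) ^ (-(n : ℝ) / 2) * (M⁻¹).det ^ (-(1 : ℝ) / 2)
  have hc : 0 ≤ c := mul_nonneg (by positivity) (Real.rpow_nonneg hpos.inv.posSemidef.det_nonneg _)
  have hquad : ∀ z : Fin n → ℝ, z ⬝ᵥ (M + diagonal d) *ᵥ z =
      ∑ i, ∑ j, z i * M i j * z j + ∑ u, d u * z u ^ 2 := by
    intro z
    rw [add_mulVec, dotProduct_add]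
    congr 1
    · simp only [dotProduct, mulVec, Finset.mul_sum, mul_assoc]
    · simp only [dotProduct, mulVec_diagonal]
      exact Finset.sum_congr rfl fun u _ => by ring
  have hweight : ∀ f : (Fin n → ℝ) → ℝ,
      ∫ z, f z * Real.exp (-(1/2) * ∑ u, d u * z u ^ 2) ∂μ =
        c * ∫ z, f z * Real.exp (-(1/2) * (z ⬝ᵥ (M + diagonal d) *ᵥ z)) := by
    intro f
    rw [hμ, nonsing_inv_nonsing_inv M hdet, integral_withDensity_eq_integral_toReal_smul
      (by fun_prop) (ae_of_all _ fun _ => ENNReal.ofReal_lt_top), ← integral_const_mul]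
    refine integral_congr_ae (ae_of_all _ fun z => ?_)
    simp only [smul_eq_mul]
    rw [ENNReal.toReal_ofReal (by positivity), hquad, mul_add, Real.exp_add]
    ring
  have hone := hweight fun _ => 1
  simp only [one_mul] at hone
  rw [hweight fun z => z x * z y, hone, hA.integral_mul_mul_exp_neg_half]
  exact (mul_assoc _ _ _).symm
end

section
/- Let n ≥ 2, let Γ : Matrix (Fin n) (Fin n) ℝ be symmetric positive definite, and let μ be the centered multivariate Gaussian measure on ℝ^n with covariance matrix Γ. Fix i ∈ Fin n. Then the conditional expectation (with respect to μ) of the coordinate function z ↦ z i, given the σ-algebra generated by the coordinate functions z ↦ z j for j ≠ i, equals μ-almost everywhere the function z ↦ ∑_{j ≠ i} (−Γ⁻¹ i j / Γ⁻¹ i i) * z j. -/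
open Matrix MeasureTheory

section GaussianReflection

lemma integrable_exp_neg_mul_sum_sq {ι : Type*} [Fintype ι] {c : ℝ} (hc : 0 < c) :
    Integrable fun z : ι → ℝ => Real.exp (-(c * ∑ k, z k ^ 2)) := by
  have h := Integrable.fintype_prod (f := fun (_ : ι) (x : ℝ) => Real.exp (-c * x ^ 2))
    (μ := fun _ => volume) fun _ => integrable_exp_neg_mul_sq hc
  refine h.congr (ae_of_all _ fun z => ?_)
  simp [← Real.exp_sum, Finset.mul_sum]

variable {ι : Type*} [Fintype ι] [DecidableEq ι]

lemma Matrix.IsSymm.sub_single_dotProduct_mulVec {P : Matrix ι ι ℝ} (hP : P.IsSymm)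
    (z : ι → ℝ) (i : ι) (t : ℝ) :
    (z - Pi.single i t) ⬝ᵥ (P *ᵥ (z - Pi.single i t)) =
      z ⬝ᵥ (P *ᵥ z) - 2 * t * (P *ᵥ z) i + t ^ 2 * P i i := by
  have h : z ⬝ᵥ (P *ᵥ Pi.single i t) = t * (P *ᵥ z) i := by
    rw [dotProduct_mulVec, ← mulVec_transpose, hP.eq, dotProduct_single, mul_comm]
  have h' : (P *ᵥ Pi.single i t) i = P i i * t := by simp [mulVec_single]
  rw [mulVec_sub, sub_dotProduct, dotProduct_sub, dotProduct_sub, h, single_dotProduct,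
    single_dotProduct, h']
  ring

/-- The reflection `z ↦ z - 2 ((P z)ᵢ / Pᵢᵢ) eᵢ` associated with the form `P`. -/
noncomputable def Matrix.coordReflection (P : Matrix ι ι ℝ) (i : ι) : (ι → ℝ) →ₗ[ℝ] (ι → ℝ) :=
  LinearMap.id -
    (LinearMap.single ℝ (fun _ : ι => ℝ) i) ∘ₗ
      ((2 / P i i) • (LinearMap.proj i ∘ₗ P.mulVecLin))

lemma Matrix.coordReflection_apply (P : Matrix ι ι ℝ) (i : ι) (z : ι → ℝ) :
    P.coordReflection i z = z - Pi.single i (2 / P i i * (P *ᵥ z) i) := by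
  simp [coordReflection]

lemma Matrix.coordReflection_apply_of_ne (P : Matrix ι ι ℝ) {i j : ι} (hij : j ≠ i)
    (z : ι → ℝ) : P.coordReflection i z j = z j := by
  simp [coordReflection_apply, hij]

lemma Matrix.mulVec_coordReflection {P : Matrix ι ι ℝ} {i : ι} (hi : P i i ≠ 0) (z : ι → ℝ) :
    (P *ᵥ P.coordReflection i z) i = -(P *ᵥ z) i := by
  rw [coordReflection_apply, mulVec_sub]
  simp only [Pi.sub_apply, mulVec_single, Pi.smul_apply, MulOpposite.smul_eq_mul_unop,
    MulOpposite.unop_op, col_apply]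
  field_simp
  ring

lemma Matrix.coordReflection_involutive {P : Matrix ι ι ℝ} {i : ι} (hi : P i i ≠ 0) :
    P.coordReflection i ∘ₗ P.coordReflection i = LinearMap.id := by
  refine LinearMap.ext fun z => ?_
  rw [LinearMap.comp_apply, coordReflection_apply, mulVec_coordReflection hi,
    coordReflection_apply, mul_neg, Pi.single_neg, sub_neg_eq_add, sub_add_cancel,
    LinearMap.id_apply]

lemma Matrix.measurePreserving_coordReflection {P : Matrix ι ι ℝ} {i : ι} (hi : P i i ≠ 0) :
    MeasurePreserving (P.coordReflection i) := by
  have h : LinearMap.det (P.coordReflection i) * LinearMap.det (P.coordReflection i) = 1 := by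
    rw [← LinearMap.det_comp, coordReflection_involutive hi, LinearMap.det_id]
  have habs : |(LinearMap.det (P.coordReflection i))⁻¹| = 1 := by
    rcases mul_self_eq_one_iff.1 h with h | h <;> simp [h]
  refine ⟨(LinearMap.continuous_of_finiteDimensional _).measurable, ?_⟩
  rw [Real.map_linearMap_volume_pi_eq_smul_volume_pi (left_ne_zero_of_mul_eq_one h), habs]
  simp

lemma Matrix.IsSymm.dotProduct_mulVec_coordReflection {P : Matrix ι ι ℝ} (hP : P.IsSymm)
    {i : ι} (hi : P i i ≠ 0) (z : ι → ℝ) :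
    P.coordReflection i z ⬝ᵥ (P *ᵥ P.coordReflection i z) = z ⬝ᵥ (P *ᵥ z) := by
  rw [coordReflection_apply, hP.sub_single_dotProduct_mulVec]
  field_simp
  ring

/-- A positive definite quadratic form dominates a positive multiple of the sum of squares. -/
lemma Matrix.PosDef.exists_mul_sum_sq_le {P : Matrix ι ι ℝ} (hP : P.PosDef) :
    ∃ c > 0, ∀ z : ι → ℝ, c * ∑ j, z j ^ 2 ≤ z ⬝ᵥ (P *ᵥ z) := by
  have hΓ : P⁻¹.PosDef := hP.inv
  have hdet : IsUnit P.det := hP.det_pos.ne'.isUnit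
  have hsymm : P.IsSymm := by simpa using hP.isHermitian
  have key (z : ι → ℝ) (j : ι) : z j ^ 2 ≤ P⁻¹ j j * (z ⬝ᵥ (P *ᵥ z)) := by
    have hj : 0 < P⁻¹ j j := hΓ.diag_pos
    set u : ι → ℝ := P⁻¹ *ᵥ Pi.single j 1 with hu
    have hPu : P *ᵥ u = Pi.single j 1 := by
      rw [hu, mulVec_mulVec, mul_nonsing_inv _ hdet, one_mulVec]
    have huj : u j = P⁻¹ j j := by simp [hu]
    have huz : u ⬝ᵥ (P *ᵥ z) = z j := by
      rw [dotProduct_mulVec, ← mulVec_transpose, hsymm.eq, hPu, single_dotProduct, one_mul]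
    have h := hP.posSemidef.dotProduct_mulVec_nonneg (P⁻¹ j j • z - z j • u)
    simp only [star_trivial, mulVec_sub, mulVec_smul, hPu, sub_dotProduct, dotProduct_sub,
      smul_dotProduct, dotProduct_smul, huz, dotProduct_single,
      Pi.sub_apply, Pi.smul_apply, huj, smul_eq_mul] at h
    have h2 : 0 ≤ P⁻¹ j j * (P⁻¹ j j * (z ⬝ᵥ (P *ᵥ z)) - z j ^ 2) := by linarith
    linarith [nonneg_of_mul_nonneg_right h2 hj]
  have hC : 0 ≤ ∑ j, P⁻¹ j j := Finset.sum_nonneg fun j _ => hΓ.diag_pos.le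
  refine ⟨(1 + ∑ j, P⁻¹ j j)⁻¹, by positivity, fun z => ?_⟩
  have hQ : 0 ≤ z ⬝ᵥ (P *ᵥ z) := by simpa using hP.posSemidef.dotProduct_mulVec_nonneg z
  rw [inv_mul_le_iff₀ (by positivity), add_mul, Finset.sum_mul]
  linarith [Finset.sum_le_sum fun j (_ : j ∈ Finset.univ) => key z j]

lemma integrable_eval_mul_exp_neg_mul_sum_sq {c : ℝ} (hc : 0 < c) (j : ι) :
    Integrable fun z : ι → ℝ => z j * Real.exp (-(c * ∑ k, z k ^ 2)) := by
  have h := Integrable.fintype_prod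
    (f := fun (k : ι) (x : ℝ) => (if k = j then x else 1) * Real.exp (-c * x ^ 2))
    (μ := fun _ => volume) fun k => by
      split_ifs
      · exact integrable_mul_exp_neg_mul_sq hc
      · simpa using integrable_exp_neg_mul_sq hc
  refine h.congr (ae_of_all _ fun z => ?_)
  beta_reduce
  rw [Finset.prod_mul_distrib, ← Real.exp_sum]
  simp [Finset.mul_sum]

lemma Matrix.PosDef.integrable_exp {P : Matrix ι ι ℝ} (hP : P.PosDef) :
    Integrable fun z : ι → ℝ => Real.exp (-(1/2) * (z ⬝ᵥ (P *ᵥ z))) := by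
  obtain ⟨c, hc, h⟩ := hP.exists_mul_sum_sq_le
  refine (integrable_exp_neg_mul_sum_sq (half_pos hc)).mono'
    (Continuous.aestronglyMeasurable (by fun_prop)) (ae_of_all _ fun z => ?_)
  rw [Real.norm_of_nonneg (Real.exp_nonneg _)]
  exact Real.exp_le_exp.2 (by linarith [h z])

lemma Matrix.PosDef.integrable_eval_mul_exp {P : Matrix ι ι ℝ} (hP : P.PosDef) (j : ι) :
    Integrable fun z : ι → ℝ => z j * Real.exp (-(1/2) * (z ⬝ᵥ (P *ᵥ z))) := by
  obtain ⟨c, hc, h⟩ := hP.exists_mul_sum_sq_le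
  refine (integrable_eval_mul_exp_neg_mul_sum_sq (half_pos hc) j).mono
    (Continuous.aestronglyMeasurable (by fun_prop)) (ae_of_all _ fun z => ?_)
  rw [norm_mul, norm_mul, Real.norm_of_nonneg (Real.exp_nonneg _),
    Real.norm_of_nonneg (Real.exp_nonneg _)]
  gcongr
  linarith [h z]

lemma MeasureTheory.MeasurePreserving.withDensity_of_comp_eq {α : Type*} [MeasurableSpace α]
    {ν : Measure α} {T : α → α} (hT : MeasurePreserving T ν ν) {d : α → ENNReal}
    (hd : Measurable d) (hdT : ∀ x, d (T x) = d x) :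
    MeasurePreserving T (ν.withDensity d) (ν.withDensity d) := by
  refine ⟨hT.measurable, Measure.ext fun s hs => ?_⟩
  rw [Measure.map_apply hT.measurable hs, withDensity_apply _ (hT.measurable hs),
    withDensity_apply _ hs, ← hT.setLIntegral_comp_preimage hs hd]
  simp [hdT]

/-- A measurable function that is odd under a measure-preserving map has zero integral over
invariant sets. -/
lemma MeasureTheory.MeasurePreserving.setIntegral_eq_zero_of_odd {α : Type*} [MeasurableSpace α]
    {ν : Measure α} {T : α → α} (hT : MeasurePreserving T ν ν) {f : α → ℝ} (hf : Measurable f)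
    (hfT : ∀ x, f (T x) = -f x) {s : Set α} (hs : MeasurableSet s) (hsT : T ⁻¹' s = s) :
    ∫ x in s, f x ∂ν = 0 := by
  have hr := hT.restrict_preimage hs
  rw [hsT] at hr
  have h := integral_map (μ := ν.restrict s) hT.measurable.aemeasurable
    (f := f) hf.aestronglyMeasurable
  rw [hr.map_eq] at h
  simp only [hfT, integral_neg] at h
  linarith

/-- In a centered Gaussian measure with precision matrix `P`, the regression of the coordinate `i`
on the others has coefficients `-Pᵢⱼ / Pᵢᵢ`. -/
theorem Matrix.PosDef.condExp_eval_withDensity_exp {P : Matrix ι ι ℝ} (hP : P.PosDef) {K : ℝ}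
    (hK0 : 0 ≤ K) {μ : Measure (ι → ℝ)}
    (hμ : μ = volume.withDensity fun z =>
      ENNReal.ofReal (K * Real.exp (-(1/2) * (z ⬝ᵥ (P *ᵥ z))))) (i : ι) :
    μ[(fun z => z i) | MeasurableSpace.comap
        (fun z (j : {j : ι // j ≠ i}) => z j.1) MeasurableSpace.pi] =ᵐ[μ]
      fun z => ∑ j ∈ Finset.univ.erase i, (-(P i j) / P i i) * z j := by
  have hPsymm : P.IsSymm := by simpa using hP.isHermitian
  have hi : P i i ≠ 0 := hP.diag_pos.ne'
  set ρ : (ι → ℝ) → ℝ := fun z => K * Real.exp (-(1/2) * (z ⬝ᵥ (P *ᵥ z))) with hρ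
  have hμ' : μ = volume.withDensity fun z => ENNReal.ofReal (ρ z) := hμ
  have hρ0 (z : ι → ℝ) : 0 ≤ ρ z := mul_nonneg hK0 (Real.exp_nonneg _)
  have hρm : Measurable ρ := Continuous.measurable (by fun_prop)
  have : IsFiniteMeasure μ := by
    rw [hμ']
    exact isFiniteMeasure_withDensity_ofReal (hP.integrable_exp.const_mul K).2
  have hint (j : ι) : Integrable (fun z : ι → ℝ => z j) μ := by
    rw [hμ', integrable_withDensity_iff hρm.ennreal_ofReal (ae_of_all _ fun _ => by simp)]
    refine ((hP.integrable_eval_mul_exp j).const_mul K).congr (ae_of_all _ fun z => ?_)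
    beta_reduce
    rw [ENNReal.toReal_ofReal (hρ0 z)]
    simp only [hρ]
    ring
  have hT : MeasurePreserving (P.coordReflection i) μ μ := by
    rw [hμ']
    refine (measurePreserving_coordReflection hi).withDensity_of_comp_eq hρm.ennreal_ofReal
      fun z => ?_
    simp only [hρ, hPsymm.dotProduct_mulVec_coordReflection hi]
  have hmle : MeasurableSpace.comap (fun (z : ι → ℝ) (j : {j : ι // j ≠ i}) => z j.1)
      MeasurableSpace.pi ≤ MeasurableSpace.pi := Measurable.comap_le (by fun_prop)
  set g : (ι → ℝ) → ℝ := fun z => ∑ j ∈ Finset.univ.erase i, (-(P i j) / P i i) * z j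
  have hgint : Integrable g μ := integrable_finsetSum _ fun j _ => (hint j).const_mul _
  have hgm : Measurable[MeasurableSpace.comap (fun (z : ι → ℝ) (j : {j : ι // j ≠ i}) => z j.1)
      MeasurableSpace.pi] g := by
    refine Finset.measurable_fun_sum _ fun j hj => Measurable.const_mul ?_ _
    exact (measurable_pi_apply (⟨j, Finset.ne_of_mem_erase hj⟩ : {j : ι // j ≠ i})).comp
      (comap_measurable (fun (z : ι → ℝ) (j : {j : ι // j ≠ i}) => z j.1))
  have hres (z : ι → ℝ) : z i - g z = (P *ᵥ z) i / P i i := by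
    simp only [g, mulVec, dotProduct]
    rw [← Finset.add_sum_erase _ _ (Finset.mem_univ i), add_div, mul_div_cancel_left₀ _ hi,
      Finset.sum_div, sub_eq_add_neg, ← Finset.sum_neg_distrib]
    congr 1
    exact Finset.sum_congr rfl fun j _ => by ring
  refine (ae_eq_condExp_of_forall_setIntegral_eq hmle (hint i)
    (fun s _ _ => hgint.integrableOn) (fun s hs _ => ?_)
    hgm.stronglyMeasurable.aestronglyMeasurable).symm
  have hsT : P.coordReflection i ⁻¹' s = s := by
    obtain ⟨t, -, rfl⟩ := hs
    ext z
    have h (j : {j : ι // j ≠ i}) : P.coordReflection i z j = z j :=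
      coordReflection_apply_of_ne P j.2 z
    simp only [Set.mem_preimage, h]
  have hzero := hT.setIntegral_eq_zero_of_odd (f := fun z => z i - g z)
    ((measurable_pi_apply i).sub (hgm.mono hmle le_rfl))
    (fun z => by rw [hres, hres, mulVec_coordReflection hi, neg_div]) (hmle s hs) hsT
  rw [integral_sub (hint i).integrableOn hgint.integrableOn] at hzero
  linarith

end GaussianReflection

theorem stmt11 (n : ℕ) (hn : 2 ≤ n) (Γ : Matrix (Fin n) (Fin n) ℝ)
    (hsymm : Γ.IsSymm) (hpos : Γ.PosDef)
    (μ : Measure (Fin n → ℝ))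
    (hμ : μ = volume.withDensity fun z =>
      ENNReal.ofReal ((2 * Real.pi) ^ (-(n : ℝ) / 2) * Γ.det ^ (-(1 : ℝ) / 2) *
        Real.exp (-(1/2) * ∑ a, ∑ b, z a * Γ⁻¹ a b * z b)))
    (i : Fin n)
    (m : MeasurableSpace (Fin n → ℝ))
    (hm : m = MeasurableSpace.comap
      (fun z (j : {j : Fin n // j ≠ i}) => z j.1) inferInstance) :
    μ[(fun z => z i) | m] =ᵐ[μ]
      fun z => ∑ j ∈ Finset.univ.erase i, (-(Γ⁻¹ i j) / Γ⁻¹ i i) * z j := by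
  have hK : 0 ≤ (2 * Real.pi) ^ (-(n : ℝ) / 2) * Γ.det ^ (-(1 : ℝ) / 2) :=
    mul_nonneg (Real.rpow_nonneg (by positivity) _) (Real.rpow_nonneg hpos.det_pos.le _)
  have hQ (z : Fin n → ℝ) : ∑ a, ∑ b, z a * Γ⁻¹ a b * z b = z ⬝ᵥ (Γ⁻¹ *ᵥ z) := by
    simp [dotProduct, mulVec, Finset.mul_sum, mul_assoc]
  simp only [hQ] at hμ
  subst hm
  exact hpos.inv.condExp_eval_withDensity_exp hK hμ i
end

section
/- Let ι be a nonempty finite type, let M : Matrix ι ι ℝ be symmetric positive definite, and let Σ = M⁻¹. Let A, B, C ⊆ ι be pairwise disjoint sets, with B nonempty, satisfying the following separation property: for every finite sequence x₀, x₁, …, x_m of elements of ι with x₀ ∈ A, x_m ∈ C, and M x_i x_{i+1} ≠ 0 for all 0 ≤ i < m, there exists 0 < i < m with x_i ∈ B. Then for every a ∈ A and c ∈ C, Σ a c = ∑_{b ∈ B} ∑_{b' ∈ B} Σ a b * ((Σ_BB)⁻¹ b b') * Σ b' c, where Σ_BB denotes the principal submatrix of Σ indexed by B; that is, the conditional covariance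 of the coordinates in A and in C, given the coordinates in B, of a centered Gaussian vector with covariance Σ vanishes. -/
open Matrix

/-- A vector annihilated by `M` on the coordinates in `R` vanishes on `R` as soon as the
coordinates outside `R` do not contribute to those equations. -/
theorem Matrix.PosDef.eq_zero_of_mulVec_eq_zero_on {ι : Type*} [Fintype ι]
    {M : Matrix ι ι ℝ} (hM : M.PosDef) (R : Set ι) (u : ι → ℝ)
    (hMu : ∀ i ∈ R, (M *ᵥ u) i = 0) (hR : ∀ i ∈ R, ∀ j ∉ R, M i j * u j = 0) :
    ∀ i ∈ R, u i = 0 := by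
  classical
  by_contra! h
  obtain ⟨i₀, hi₀, hui₀⟩ := h
  have hz : R.indicator u ≠ 0 := fun h => hui₀ (by simpa [hi₀] using congrFun h i₀)
  refine (hM.dotProduct_mulVec_pos hz).ne' (Finset.sum_eq_zero fun i _ => ?_)
  by_cases hi : i ∈ R
  · have : (M *ᵥ R.indicator u) i = (M *ᵥ u) i := by
      refine Finset.sum_congr rfl fun j _ => ?_
      by_cases hj : j ∈ R
      · simp [hj]
      · simp [hj, hR i hi j hj]
    rw [this, hMu i hi, mul_zero]
  · simp [hi]

/-- A separating set `B` yields a set `R` containing `A`, disjoint from `B` and `C`, whose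
neighbours outside `R` all lie in `B`. -/
theorem exists_closed_set_of_separates {ι : Type*} (r : ι → ι → Prop) (A B C : Finset ι)
    (hAB : Disjoint A B)
    (hsep : ∀ (m : ℕ) (x : ℕ → ι), x 0 ∈ A → x m ∈ C →
      (∀ i < m, r (x i) (x (i + 1))) → ∃ i, 0 < i ∧ i < m ∧ x i ∈ B) :
    ∃ R : Set ι, (∀ a ∈ A, a ∈ R) ∧ (∀ b ∈ B, b ∉ R) ∧ (∀ c ∈ C, c ∉ R) ∧
      ∀ i ∈ R, ∀ j ∉ R, r i j → j ∈ B := by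
  refine ⟨{y | ∃ (m : ℕ) (x : ℕ → ι), x 0 ∈ A ∧ x m = y ∧ (∀ i < m, r (x i) (x (i + 1))) ∧
    ∀ i ≤ m, x i ∉ B}, ?_, ?_, ?_, ?_⟩
  · intro a ha
    exact ⟨0, fun _ => a, ha, rfl, by simp, fun _ _ => Finset.disjoint_left.1 hAB ha⟩
  · rintro b hb ⟨m, x, -, rfl, -, hx⟩
    exact hx m le_rfl hb
  · rintro c hc ⟨m, x, h0, rfl, hr, hx⟩
    obtain ⟨i, -, him, hi⟩ := hsep m x h0 hc hr
    exact hx i him.le hi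
  · rintro i ⟨m, x, h0, rfl, hr, hx⟩ j hj hij
    by_contra hjB
    refine hj ⟨m + 1, fun k => if k ≤ m then x k else j, by simpa using h0, by simp, ?_, ?_⟩
    · intro k hk
      rcases (Nat.lt_succ_iff.1 hk).lt_or_eq with hk | rfl
      · simpa [hk.le, Nat.succ_le_of_lt hk] using hr k hk
      · simpa using hij
    · intro k _
      by_cases hk : k ≤ m
      · simpa [hk] using hx k hk
      · simpa [hk] using hjB

theorem stmt12 {ι : Type*} [Fintype ι] [Nonempty ι] [DecidableEq ι]
    (M : Matrix ι ι ℝ) (hsymm : M.IsSymm) (hpos : M.PosDef)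
    (A B C : Finset ι) (hB : B.Nonempty)
    (hAB : Disjoint A B) (hBC : Disjoint B C) (hAC : Disjoint A C)
    (hsep : ∀ (m : ℕ) (x : ℕ → ι), x 0 ∈ A → x m ∈ C →
      (∀ i < m, M (x i) (x (i + 1)) ≠ 0) → ∃ i, 0 < i ∧ i < m ∧ x i ∈ B) :
    ∀ a ∈ A, ∀ c ∈ C,
      M⁻¹ a c = ∑ b : {x // x ∈ B}, ∑ b' : {x // x ∈ B},
        M⁻¹ a b.1 *
          (((M⁻¹).submatrix (Subtype.val : {x // x ∈ B} → ι) Subtype.val)⁻¹ b b') *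
          M⁻¹ b'.1 c := by
  intro a ha c hc
  obtain ⟨R, hAR, hBR, hCR, hR⟩ :=
    exists_closed_set_of_separates (fun i j => M i j ≠ 0) A B C hAB hsep
  set S := (M⁻¹).submatrix (Subtype.val : {x // x ∈ B} → ι) Subtype.val
  have hSdet : IsUnit S.det :=
    (isUnit_iff_isUnit_det S).1 (hpos.inv.submatrix Subtype.val_injective).isUnit
  have hMdet : IsUnit M.det := (isUnit_iff_isUnit_det M).1 hpos.isUnit
  set w : {x // x ∈ B} → ℝ := S⁻¹ *ᵥ fun b' => M⁻¹ b'.1 c with hw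
  have hSw : S *ᵥ w = fun b' => M⁻¹ b'.1 c := by
    rw [hw, mulVec_mulVec, mul_nonsing_inv S hSdet, one_mulVec]
  set N : Matrix ι {x // x ∈ B} ℝ := (M⁻¹).submatrix id Subtype.val with hN
  set u : ι → ℝ := (M⁻¹).col c - N *ᵥ w with hu
  have huB : ∀ b ∈ B, u b = 0 := fun b hb => sub_eq_zero.2 (congrFun hSw ⟨b, hb⟩).symm
  have hMN : M * N = (1 : Matrix ι ι ℝ).submatrix id Subtype.val := by
    rw [← mul_nonsing_inv M hMdet]
    rfl
  have hMc : M *ᵥ (M⁻¹).col c = (1 : Matrix ι ι ℝ).col c := by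
    rw [← mul_nonsing_inv M hMdet]
    rfl
  have hMu : ∀ i ∈ R, (M *ᵥ u) i = 0 := by
    intro i hi
    have hic : i ≠ c := by rintro rfl; exact hCR _ hc hi
    have hib : ∀ b : {x // x ∈ B}, i ≠ b.1 := by rintro b rfl; exact hBR _ b.2 hi
    rw [hu, mulVec_sub, mulVec_mulVec, hMN, hMc]
    simp [mulVec, dotProduct, one_apply, hic, hib]
  have hua := hpos.eq_zero_of_mulVec_eq_zero_on R u hMu (fun i hi j hj => by
    by_cases hij : M i j = 0
    · simp [hij]
    · simp [huB j (hR i hi j hj hij)]) a (hAR a ha)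
  have hac : M⁻¹ a c = (N *ᵥ w) a := sub_eq_zero.1 hua
  rw [hac]
  simp [hw, hN, mulVec, dotProduct, Finset.mul_sum, mul_assoc]
end

section
/- Let ι be a finite type with at least two elements, let M : Matrix ι ι ℝ be symmetric and strictly diagonally dominant with positive diagonal (M x x > ∑_{y ≠ x} |M x y| for all x), and fix z ∈ ι. Define M' on the indices x, y ≠ z by M' x y = M x y − M x z * M z y / M z z. Then M' is symmetric and strictly diagonally dominant with positive diagonal: M' x x > ∑_{y ≠ x, y ≠ z} |M' x y| for every x ≠ z. -/
theorem stmt13 {ι : Type*} [Fintype ι] [DecidableEq ι] (hcard : 2 ≤ Fintype.card ι)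
    (M : Matrix ι ι ℝ) (hsymm : M.IsSymm)
    (hdom : ∀ x, ∑ y ∈ Finset.univ.erase x, |M x y| < M x x)
    (z : ι)
    (M' : Matrix {x : ι // x ≠ z} {x : ι // x ≠ z} ℝ)
    (hM' : ∀ x y, M' x y = M x.1 y.1 - M x.1 z * M z y.1 / M z z) :
    (∀ x y, M' x y = M' y x) ∧
      ∀ x, ∑ y ∈ Finset.univ.erase x, |M' x y| < M' x x := by
  refine ⟨fun x y => ?_, fun x => ?_⟩
  · rw [hM', hM', hsymm.apply x.1 y.1, hsymm.apply x.1 z, hsymm.apply z y.1, mul_comm]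
  have hz : 0 < M z z := (Finset.sum_nonneg fun _ _ => abs_nonneg _).trans_lt (hdom z)
  have split (f : ι → ℝ) :
      ∑ y, f y = f z + (f x + ∑ y ∈ Finset.univ.erase x, f (y : {x : ι // x ≠ z})) := by
    rw [Fintype.sum_eq_add_sum_subtype_ne f z, Finset.add_sum_erase _ (fun y : {x : ι // x ≠ z} => f y)
      (Finset.mem_univ x)]
  have hx := hdom x
  have hz' := hdom z
  rw [Finset.sum_erase_eq_sub (Finset.mem_univ _), split] at hx hz'
  have hzx : M z x = M x z := hsymm.apply x.1 z
  rw [hzx] at hz'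
  set a := |M x z| with ha
  have ha0 : 0 ≤ a / M z z := div_nonneg (abs_nonneg _) hz.le
  have bound : ∑ y ∈ Finset.univ.erase x, |M' x y| ≤
      ∑ y ∈ Finset.univ.erase x, |M x y| +
        a / M z z * ∑ y ∈ Finset.univ.erase x, |M z y| := by
    rw [Finset.mul_sum, ← Finset.sum_add_distrib]
    refine Finset.sum_le_sum fun y _ => ?_
    rw [hM']
    refine (abs_sub _ _).trans_eq ?_
    rw [abs_div, abs_mul, abs_of_pos hz, ha]
    ring
  have mixed : a / M z z * ∑ y ∈ Finset.univ.erase x, |M z y| ≤ a / M z z * (M z z - a) :=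
    mul_le_mul_of_nonneg_left (by linarith) ha0
  have diag : M' x x = M x x - a + a / M z z * (M z z - a) := by
    rw [hM', hzx, ← abs_mul_abs_self (M x z), ← ha]
    field_simp
    ring
  linarith
end

section
/- Let a : ℝ. Define Σ : ℕ → ℕ → ℝ on indices k, l ≥ 1 by Σ k l = a^(l−k) * ∑_{i=1}^{k} a^(2(k−i)) when k ≤ l, and Σ k l = Σ l k when l < k. Define Q : ℕ → ℕ → ℝ on indices k, l ≥ 1 by Q k l = −(1 + a²) if k = l, Q k l = a if |k − l| = 1, and Q k l = 0 otherwise. Then for all k, l ≥ 1, ∑_{j ≥ 1} Q k j * Σ j l = −(if k = l then 1 else 0), where the sum has only finitely many nonzero terms. -/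
theorem sum_Icc_one_pow_two_mul_sub_succ (a : ℝ) (k : ℕ) :
    ∑ i ∈ Finset.Icc 1 (k + 1), a ^ (2 * (k + 1 - i)) =
      a ^ 2 * ∑ i ∈ Finset.Icc 1 k, a ^ (2 * (k - i)) + 1 := by
  rw [Finset.sum_Icc_succ_top (by omega), Finset.mul_sum]
  congr 1
  · refine Finset.sum_congr rfl fun i hi => ?_
    rw [Finset.mem_Icc] at hi
    rw [← pow_add]
    congr 1
    omega
  · simp

theorem stmt14 (a : ℝ) (Cov Q : ℕ → ℕ → ℝ)
    (hCov : ∀ k l, 1 ≤ k → k ≤ l →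
      Cov k l = a ^ (l - k) * ∑ i ∈ Finset.Icc 1 k, a ^ (2 * (k - i)))
    (hCovsymm : ∀ k l, 1 ≤ l → l < k → Cov k l = Cov l k)
    (hQ : ∀ k l, 1 ≤ k → 1 ≤ l →
      Q k l = if k = l then -(1 + a ^ 2) else if k = l + 1 ∨ l = k + 1 then a else 0) :
    ∀ k l, 1 ≤ k → 1 ≤ l →
      {j : ℕ | 1 ≤ j ∧ Q k j * Cov j l ≠ 0}.Finite ∧
      ∑' j : ℕ, (if 1 ≤ j then Q k j * Cov j l else 0) =
        -(if k = l then 1 else 0) := by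
  intro k l hk hl
  obtain ⟨m, rfl⟩ : ∃ m, k = m + 1 := ⟨k - 1, by omega⟩
  have hQ_zero : ∀ j, 1 ≤ j → j ∉ ({m, m + 1, m + 2} : Finset ℕ) → Q (m + 1) j = 0 := by
    intro j hj hmem
    simp only [Finset.mem_insert, Finset.mem_singleton, not_or] at hmem
    rw [hQ _ _ hk hj, if_neg (by omega), if_neg (by omega)]
  refine ⟨(Finset.finite_toSet {m, m + 1, m + 2}).subset ?_, ?_⟩
  · rintro j ⟨hj, hne⟩
    by_contra hmem
    exact hne (by rw [hQ_zero j hj hmem, zero_mul])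
  have hQ_diag : Q (m + 1) (m + 1) = -(1 + a ^ 2) := by
    rw [hQ _ _ hk hk, if_pos rfl]
  have hQ_up : Q (m + 1) (m + 2) = a := by
    rw [hQ _ _ hk (by omega), if_neg (by omega), if_pos (by omega)]
  have hQ_down : 1 ≤ m → Q (m + 1) m = a := fun hm => by
    rw [hQ _ _ hk hm, if_neg (by omega), if_pos (by omega)]
  rw [tsum_eq_sum (s := {m, m + 1, m + 2}) (fun j hmem => by
      split_ifs with hj
      · rw [hQ_zero j hj hmem, zero_mul]
      · rfl),
    Finset.sum_insert (by simp), Finset.sum_insert (by simp), Finset.sum_singleton,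
    if_pos hk, if_pos (show 1 ≤ m + 2 by omega), hQ_diag, hQ_up]
  set S : ℕ → ℝ := fun k => ∑ i ∈ Finset.Icc 1 k, a ^ (2 * (k - i)) with hS
  have hS_succ : ∀ k, S (k + 1) = a ^ 2 * S k + 1 := sum_Icc_one_pow_two_mul_sub_succ a
  have hCov_le : ∀ k d, 1 ≤ k → Cov k (k + d) = a ^ d * S k := fun k d hk => by
    rw [hCov k (k + d) hk (by omega), Nat.add_sub_cancel_left]
  have hCov_ge : ∀ k d, 1 ≤ k → Cov (k + d) k = a ^ d * S k := fun k d hk => by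
    rcases Nat.eq_zero_or_pos d with rfl | hd
    · exact hCov_le k 0 hk
    · rw [hCovsymm _ _ hk (by omega), hCov_le k d hk]
  rcases le_or_gt l m with hlm | hml
  · obtain ⟨d, rfl⟩ := Nat.exists_eq_add_of_le hlm
    rw [if_pos (by omega), hQ_down (by omega), if_neg (by omega), hCov_ge l d hl,
      add_assoc l d 1, add_assoc l d 2, hCov_ge l _ hl, hCov_ge l _ hl]
    ring
  · obtain ⟨d, rfl⟩ := Nat.exists_eq_add_of_le (Nat.succ_le_of_lt hml)
    have hdown : (if 1 ≤ m then Q (m + 1) m * Cov m (m.succ + d) else 0) =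
        a * (a ^ (d + 1) * S m) := by
      split_ifs with hm
      · rw [hQ_down hm, show m.succ + d = m + (d + 1) by omega, hCov_le m _ hm]
      · obtain rfl : m = 0 := by omega
        simp [hS]
    rw [hdown, Nat.succ_eq_add_one, hCov_le (m + 1) d hk]
    rcases d with _ | d
    · rw [add_zero, if_pos rfl, hCov_ge (m + 1) 1 hk, hS_succ]
      ring
    · rw [if_neg (by omega), show m + 1 + (d + 1) = m + 2 + d by omega,
        hCov_le (m + 2) d (by omega), hS_succ (m + 1), hS_succ m]
      ring
end

section
/- Let a : ℝ and let s : ℕ → ℝ satisfy s j ∈ {−1, 1} for all j. Define Σ' : ℕ → ℕ → ℝ on indices k, l ≥ 1 by Σ' k l = (∏_{j=k+1}^{l} s j) * a^(l−k) * ∑_{i=1}^{k} a^(2(k−i)) when k ≤ l, and Σ' k l = Σ' l k when l < k. Define Q_S : ℕ → ℕ → ℝ on indices k, l ≥ 1 by Q_S k l = −(1 + a²) if k = l, Q_S k l = a * s (max k l) if |k − l| = 1, and Q_S k l = 0 otherwise. Then for all k, l ≥ 1, ∑_{j ≥ 1} (−(Q_S k j)) * Σ' j l = (if k = l then 1 else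 0), where the sum has only finitely many nonzero terms. -/
/-- The signed covariance on and above the diagonal. For `k = 0` it vanishes. -/
noncomputable def signedCov (a : ℝ) (s : ℕ → ℝ) (k l : ℕ) : ℝ :=
  (∏ j ∈ Finset.Icc (k + 1) l, s j) * a ^ (l - k) * ∑ i ∈ Finset.Icc 1 k, a ^ (2 * (k - i))

theorem sum_pow_two_mul_sub_succ (a : ℝ) (k : ℕ) :
    ∑ i ∈ Finset.Icc 1 (k + 1), a ^ (2 * (k + 1 - i)) =
      1 + a ^ 2 * ∑ i ∈ Finset.Icc 1 k, a ^ (2 * (k - i)) := by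
  rw [Finset.sum_Icc_succ_top (by omega), Finset.mul_sum, add_comm]
  congr 1
  · simp
  · refine Finset.sum_congr rfl fun i hi => ?_
    have := (Finset.mem_Icc.mp hi).2
    rw [← pow_add]
    congr 1
    omega

theorem signedCov_zero (a : ℝ) (s : ℕ → ℝ) (l : ℕ) : signedCov a s 0 l = 0 := by
  simp [signedCov]

theorem signedCov_succ_right (a : ℝ) (s : ℕ → ℝ) {k l : ℕ} (h : k ≤ l) :
    signedCov a s k (l + 1) = a * s (l + 1) * signedCov a s k l := by
  rw [signedCov, signedCov, Finset.prod_Icc_succ_top (by omega), Nat.succ_sub h, pow_succ]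
  ring

theorem signedCov_self_succ (a : ℝ) (s : ℕ → ℝ) (k : ℕ) :
    signedCov a s (k + 1) (k + 1) = 1 + a ^ 2 * signedCov a s k k := by
  simp [signedCov, sum_pow_two_mul_sub_succ]

theorem signedCov_three_term (a : ℝ) (s : ℕ → ℝ) (hs : ∀ j, s j * s j = 1) {m l : ℕ}
    (h : m + 2 ≤ l) :
    (1 + a ^ 2) * signedCov a s (m + 1) l =
      a * s (m + 1) * signedCov a s m l + a * s (m + 2) * signedCov a s (m + 2) l := by
  obtain ⟨d, rfl⟩ := Nat.exists_eq_add_of_le h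
  have e₁ : m + 2 + d - m = d + 2 := by omega
  have e₂ : m + 2 + d - (m + 1) = d + 1 := by omega
  have e₃ : m + 2 + d - (m + 2) = d := by omega
  have p₁ : ∏ j ∈ Finset.Icc (m + 1) (m + 2 + d), s j =
      s (m + 1) * ∏ j ∈ Finset.Icc (m + 2) (m + 2 + d), s j := by
    rw [← Finset.mul_prod_Ioc_eq_prod_Icc (by omega), ← Finset.Icc_add_one_left_eq_Ioc]
    rfl
  have p₂ : ∏ j ∈ Finset.Icc (m + 2) (m + 2 + d), s j =
      s (m + 2) * ∏ j ∈ Finset.Icc (m + 3) (m + 2 + d), s j := by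
    rw [← Finset.mul_prod_Ioc_eq_prod_Icc (by omega), ← Finset.Icc_add_one_left_eq_Ioc]
    rfl
  simp only [signedCov, e₁, e₂, e₃, p₁, p₂, sum_pow_two_mul_sub_succ a (m + 1),
    sum_pow_two_mul_sub_succ a m]
  generalize ∏ j ∈ Finset.Icc (m + 3) (m + 2 + d), s j = P
  generalize ∑ i ∈ Finset.Icc 1 m, a ^ (2 * (m - i)) = G
  linear_combination (-(a ^ (d + 3) * s (m + 2) * P * G)) * hs (m + 1)


theorem stmt15 (a : ℝ) (s : ℕ → ℝ) (hs : ∀ j, s j = -1 ∨ s j = 1)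
    (Cov QS : ℕ → ℕ → ℝ)
    (hCov : ∀ k l, 1 ≤ k → k ≤ l →
      Cov k l = (∏ j ∈ Finset.Icc (k + 1) l, s j) * a ^ (l - k) *
        ∑ i ∈ Finset.Icc 1 k, a ^ (2 * (k - i)))
    (hCovsymm : ∀ k l, 1 ≤ l → l < k → Cov k l = Cov l k)
    (hQS : ∀ k l, 1 ≤ k → 1 ≤ l →
      QS k l = if k = l then -(1 + a ^ 2)
        else if k = l + 1 ∨ l = k + 1 then a * s (max k l) else 0) :
    ∀ k l, 1 ≤ k → 1 ≤ l →
      {j : ℕ | 1 ≤ j ∧ (-(QS k j)) * Cov j l ≠ 0}.Finite ∧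
      ∑' j : ℕ, (if 1 ≤ j then (-(QS k j)) * Cov j l else 0) =
        (if k = l then 1 else 0) := by
  intro k l hk hl
  have hss : ∀ j, s j * s j = 1 := fun j => by rcases hs j with h | h <;> simp [h]
  obtain ⟨m, rfl⟩ : ∃ m, k = m + 1 := ⟨k - 1, by omega⟩
  have hzero : ∀ j, 1 ≤ j → j ∉ Finset.Icc m (m + 2) → QS (m + 1) j = 0 := by
    intro j hj hjm
    rw [Finset.mem_Icc] at hjm
    rw [hQS _ _ hk hj, if_neg (by omega), if_neg (by omega)]
  refine ⟨(Finset.Icc m (m + 2)).finite_toSet.subset ?_, ?_⟩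
  · rintro j ⟨hj, hne⟩
    by_contra hjm
    exact hne (by rw [hzero j hj hjm]; simp)
  have hup : ∀ j, 1 ≤ j → j ≤ l → Cov j l = signedCov a s j l := fun j h₁ h₂ => hCov j l h₁ h₂
  have hlow : ∀ j, l ≤ j → Cov j l = signedCov a s l j := by
    intro j h
    rcases h.eq_or_lt with rfl | h'
    · exact hCov _ _ hl le_rfl
    · rw [hCovsymm j l hl h']
      exact hCov _ _ hl h
  have hdiag : QS (m + 1) (m + 1) = -(1 + a ^ 2) := by
    rw [hQS _ _ hk hk, if_pos rfl]
  have hsuper : QS (m + 1) (m + 2) = a * s (m + 2) := by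
    rw [hQS _ _ hk (by omega), if_neg (by omega), if_pos (by omega), max_eq_right (by omega)]
  have hsub : 1 ≤ m → QS (m + 1) m = a * s (m + 1) := by
    intro hm
    rw [hQS _ _ hk hm, if_neg (by omega), if_pos (by omega), max_eq_left (by omega)]
  have hleft : m ≤ l → (if 1 ≤ m then -(QS (m + 1) m) * Cov m l else 0) =
      -(a * s (m + 1)) * signedCov a s m l := by
    intro hml
    split_ifs with hm
    · rw [hsub hm, hup m hm hml]
    · obtain rfl : m = 0 := by omega
      rw [signedCov_zero, mul_zero]
  rw [tsum_eq_sum (s := Finset.Icc m (m + 2))]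
  swap
  · intro j hjm
    split_ifs with hj
    · rw [hzero j hj hjm]; simp
    · rfl
  rw [Finset.sum_Icc_succ_top (by omega), Finset.sum_Icc_succ_top (by omega), Finset.Icc_self,
    Finset.sum_singleton, if_pos (show 1 ≤ m + 1 by omega), if_pos (show 1 ≤ m + 1 + 1 by omega),
    hdiag, show m + 1 + 1 = m + 2 from rfl, hsuper]
  rcases lt_trichotomy (m + 1) l with h | rfl | h
  · rw [hleft (by omega), hup (m + 1) hk (by omega), hup (m + 2) (by omega) (by omega),
      if_neg (by omega)]
    linear_combination signedCov_three_term a s hss (show m + 2 ≤ l by omega)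
  · rw [hleft (by omega), hlow (m + 1) le_rfl, hlow (m + 2) (by omega), if_pos rfl,
      signedCov_succ_right a s (le_refl (m + 1)),
      signedCov_succ_right a s (le_refl m),
      signedCov_self_succ]
    linear_combination (-(a ^ 2 * signedCov a s m m)) * hss (m + 1) -
      a ^ 2 * (1 + a ^ 2 * signedCov a s m m) * hss (m + 2)
  · rw [if_pos (show 1 ≤ m by omega), hsub (by omega), hlow m (by omega),
      hlow (m + 1) (by omega), hlow (m + 2) (by omega), if_neg (by omega),
      signedCov_succ_right a s (show l ≤ m + 1 by omega),
      signedCov_succ_right a s (show l ≤ m by omega)]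
    linear_combination (-(a ^ 3 * s (m + 1) * signedCov a s l m)) * hss (m + 2)
end
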